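/- Let X ≥ 2 be real, M, K ≥ 2, and let F : ℕ → ℂ satisfy |F(x)| ≤ X for all x. Let (a_m) and (b_k) be complex numbers with |a_m| ≤ 1 and |b_k| ≤ 1, and define the bilinear form ℬ(M,K) = ∑_{M ≤ m < 2M} ∑_{K ≤ k < 2K, m < k} a_m b_k F(mk) and 𝓛 = log(2MKX). Then there exist complex numbers (a′_m) and (b′_k) with |a′_m| ≤ |a_m| and |b′_k| ≤ |b_k| for all m, k, such that |ℬ(M,K)| ≤ C (𝓛 |∑_{M ≤ m < 2M} ∑_{K ≤ k < 2K} a′_m b′_k F(mk)| + (XMK)^{−1}) for an absolute constant C. The same conclusion holds if the summation condition m < k in the definition of ℬ(M,K) is replaced by U ≤ mk < U′ for any reals U < U′. -/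

import Mathlib

noncomputable section

/-- Bilinear sum with a restriction. -/
def bsum (s t : Finset ℕ) (G : ℕ → ℕ → ℂ) (a b : ℕ → ℂ) (P : ℕ → ℕ → Prop) : ℂ :=
  open Classical in ∑ m ∈ s, ∑ k ∈ t, (if P m k then a m * b k * G m k else 0)

theorem bsum_eq_bound (s t : Finset ℕ) (G : ℕ → ℕ → ℂ) (a0 b0 : ℕ → ℂ) (T : ℝ)
    (hT : ∀ a b : ℕ → ℂ, (∀ m, ‖a m‖ ≤ ‖a0 m‖) → (∀ k, ‖b k‖ ≤ ‖b0 k‖) →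
      ‖bsum s t G a b (fun _ _ => True)‖ ≤ T) (L : ℕ) :
    ∀ (g f : ℕ → ℕ), (∀ m, g m < 2 ^ L) → (∀ k, f k < 2 ^ L) →
    ∀ a b : ℕ → ℂ, (∀ m, ‖a m‖ ≤ ‖a0 m‖) → (∀ k, ‖b k‖ ≤ ‖b0 k‖) →
      ‖bsum s t G a b (fun m k => f k = g m)‖ ≤ T := by
  induction L with
  | zero =>
    intro g f hg hf a b ha hb
    have : (fun m k => f k = g m) = (fun _ _ => True) := by
      funext m k
      have := hg m
      have := hf k
      simp at *
      omega
    rw [this]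
    exact hT a b ha hb
  | succ L ih =>
    intro g f hg hf a b ha hb
    have h1 := ih (fun m => g m / 2) (fun k => f k / 2)
      (fun m => by have := hg m; rw [pow_succ] at this; omega)
      (fun m => by have := hf m; rw [pow_succ] at this; omega)
    have e : bsum s t G a b (fun m k => f k = g m) =
        (bsum s t G a b (fun m k => f k / 2 = g m / 2) +
         bsum s t G (fun m => a m * (-1) ^ (g m)) (fun k => b k * (-1) ^ (f k))
          (fun m k => f k / 2 = g m / 2)) / 2 := by
      unfold bsum
      rw [← Finset.sum_add_distrib, Finset.sum_div]
      refine Finset.sum_congr rfl fun m _ => ?_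
      rw [← Finset.sum_add_distrib, Finset.sum_div]
      refine Finset.sum_congr rfl fun k _ => ?_
      by_cases h : f k / 2 = g m / 2
      · by_cases h' : f k = g m
        · have : ((-1 : ℂ) ^ (g m)) * (-1) ^ (g m) = 1 := by
            rw [← mul_pow]; simp
          simp only [h, h', if_true]
          linear_combination (-(a m * b k * G m k) / 2) * this
        · have : ((-1 : ℂ) ^ (g m)) * (-1) ^ (f k) = -1 := by
            rw [← pow_add]
            apply Odd.neg_one_pow
            rw [Nat.odd_iff]; omega
          simp only [h, h', if_true, if_false]
          linear_combination (-(a m * b k * G m k) / 2) * this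
      · have h' : ¬ f k = g m := by
          intro h'; rw [h'] at h; exact h rfl
        simp [h, h']
    have b1 := h1 a b ha hb
    have b2 := h1 (fun m => a m * (-1) ^ (g m)) (fun k => b k * (-1) ^ (f k))
      (fun m => by simpa using ha m) (fun m => by simpa using hb m)
    rw [e, norm_div]
    have := norm_add_le (bsum s t G a b (fun m k => f k / 2 = g m / 2))
      (bsum s t G (fun m => a m * (-1) ^ (g m)) (fun k => b k * (-1) ^ (f k))
          (fun m k => f k / 2 = g m / 2))
    simp only [Complex.norm_ofNat]
    linarith

theorem bsum_lt_bound (s t : Finset ℕ) (G : ℕ → ℕ → ℂ) (a b : ℕ → ℂ) (T : ℝ)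
    (hT : ∀ a' b' : ℕ → ℂ, (∀ m, ‖a' m‖ ≤ ‖a m‖) → (∀ k, ‖b' k‖ ≤ ‖b k‖) →
      ‖bsum s t G a' b' (fun _ _ => True)‖ ≤ T) (L : ℕ) :
    ∀ (g f : ℕ → ℕ), (∀ m, g m < 2 ^ L) → (∀ k, f k < 2 ^ L) →
      ‖bsum s t G a b (fun m k => f k < g m)‖ ≤ L * T := by
  induction L with
  | zero =>
    intro g f hg hf
    have : (fun m k => f k < g m) = (fun _ _ => False) := by
      funext m k
      have := hg m
      have := hf k
      simp at *
      omega
    rw [this]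
    simp [bsum]
  | succ L ih =>
    intro g f hg hf
    have hg' : ∀ m, g m / 2 < 2 ^ L := 
      (fun m => by have := hg m; rw [pow_succ] at this; omega)
    have hf' : ∀ m, f m / 2 < 2 ^ L := 
      (fun m => by have := hf m; rw [pow_succ] at this; omega)
    have b1 := ih (fun m => g m / 2) (fun k => f k / 2) hg' hf'
    have b2 := bsum_eq_bound s t G a b T hT L (fun m => g m / 2) (fun k => f k / 2) hg' hf'
      (fun m => if g m % 2 = 1 then a m else 0) (fun k => if f k % 2 = 0 then b k else 0)
      (fun m => by split_ifs <;> simp) (fun m => by split_ifs <;> simp)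
    have e : bsum s t G a b (fun m k => f k < g m) =
        bsum s t G a b (fun m k => f k / 2 < g m / 2) +
         bsum s t G (fun m => if g m % 2 = 1 then a m else 0)
          (fun k => if f k % 2 = 0 then b k else 0) (fun m k => f k / 2 = g m / 2) := by
      unfold bsum
      rw [← Finset.sum_add_distrib]
      refine Finset.sum_congr rfl fun m _ => ?_
      rw [← Finset.sum_add_distrib]
      refine Finset.sum_congr rfl fun k _ => ?_
      by_cases c : f k / 2 < g m / 2
      · have c1 : f k < g m := by omega
        have c2 : ¬ f k / 2 = g m / 2 := by omega
        simp [c, c1, c2]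
      · by_cases c2 : f k / 2 = g m / 2
        · by_cases c3 : f k % 2 = 0
          · by_cases c4 : g m % 2 = 1
            · have c1 : f k < g m := by omega
              simp [c1, c2, c3, c4]
            · have c1 : ¬ f k < g m := by omega
              simp [c1, c2, c4]
          · have c1 : ¬ f k < g m := by omega
            simp [c1, c2, c3]
        · have c1 : ¬ f k < g m := by omega
          simp [c, c1, c2]
    rw [e]
    refine (norm_add_le _ _).trans ?_
    push_cast
    linarith

theorem bsum_nat_bound (s : Finset ℕ) (n : ℕ) (G : ℕ → ℕ → ℂ) (a b : ℕ → ℂ) (T : ℝ)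
    (hT : ∀ a' b' : ℕ → ℂ, (∀ m, ‖a' m‖ ≤ ‖a m‖) → (∀ k, ‖b' k‖ ≤ ‖b k‖) →
      ‖bsum s (Finset.range n) G a' b' (fun _ _ => True)‖ ≤ T) (g : ℕ → ℕ) :
      ‖bsum s (Finset.range n) G a b (fun m k => k < g m)‖ ≤ (Nat.log 2 n + 1 : ℕ) * T := by
  have hn : n < 2 ^ (Nat.log 2 n + 1) := Nat.lt_pow_succ_log_self (by norm_num) n
  have := bsum_lt_bound s (Finset.range n) G a b T hT (Nat.log 2 n + 1)
    (fun m => min (g m) n) (fun k => min k n) (fun m => by omega)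
    (fun m => by omega)
  convert this using 2
  unfold bsum
  refine Finset.sum_congr rfl fun m _ => Finset.sum_congr rfl fun k hk => ?_
  rw [Finset.mem_range] at hk
  have : k < g m ↔ min k n < min (g m) n := by omega
  by_cases c : k < g m
  · have c' := this.1 c
    rw [if_pos c, if_pos c']
  · have c' := fun z => c (this.2 z)
    rw [if_neg c, if_neg c']

theorem key (X M K : ℝ) (F : ℕ → ℂ) (a b : ℕ → ℂ) (hX : 2 ≤ X) (hM : 2 ≤ M) (hK : 2 ≤ K)
    (B : ℂ)
    (hB : ∃ g h : ℕ → ℕ, B =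
      bsum (Finset.range (⌊2 * M⌋₊ + 1)) (Finset.range (⌊2 * K⌋₊ + 1))
       (fun m k => if M ≤ (m : ℝ) ∧ (m : ℝ) < 2 * M ∧ K ≤ (k : ℝ) ∧ (k : ℝ) < 2 * K then
         F (m * k) else 0) a b (fun m k => k < g m) -
      bsum (Finset.range (⌊2 * M⌋₊ + 1)) (Finset.range (⌊2 * K⌋₊ + 1))
       (fun m k => if M ≤ (m : ℝ) ∧ (m : ℝ) < 2 * M ∧ K ≤ (k : ℝ) ∧ (k : ℝ) < 2 * K then
         F (m * k) else 0) a b (fun m k => k < h m)) :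
    ∃ a' b' : ℕ → ℂ, (∀ m : ℕ, ‖a' m‖ ≤ ‖a m‖) ∧ (∀ k : ℕ, ‖b' k‖ ≤ ‖b k‖) ∧
      ‖B‖ ≤
        6 * (Real.log (2 * M * K * X) *
            ‖∑ m ∈ Finset.range (⌊2 * M⌋₊ + 1), ∑ k ∈ Finset.range (⌊2 * K⌋₊ + 1),
              (if M ≤ (m : ℝ) ∧ (m : ℝ) < 2 * M ∧ K ≤ (k : ℝ) ∧ (k : ℝ) < 2 * K
               then a' m * b' k * F (m * k) else 0)‖ + (X * M * K)⁻¹) := by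
  obtain ⟨g, h, hB⟩ := hB
  by_contra! hc
  set s := Finset.range (⌊2 * M⌋₊ + 1)
  set n := ⌊2 * K⌋₊ + 1 with hn
  set G : ℕ → ℕ → ℂ := (fun m k => if M ≤ (m : ℝ) ∧ (m : ℝ) < 2 * M ∧ K ≤ (k : ℝ) ∧
      (k : ℝ) < 2 * K then F (m * k) else 0) with hG
  set l := Real.log (2 * M * K * X) with hl
  have hMK : 2 * 2 ≤ M * K := by gcongr
  have hnle : (n : ℝ) ≤ 2 * M * K * X := by
    have : (⌊2 * K⌋₊ : ℝ) ≤ 2 * K := Nat.floor_le (by linarith)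
    have h2 : (2 * K) * 2 * 2 ≤ (2 * K) * M * X := by gcongr
    rw [hn]; push_cast; nlinarith
  have h16 : 16 ≤ 2 * M * K * X := by nlinarith
  have hl2 : 4 * Real.log 2 ≤ l := by
    have : Real.log ((2 : ℝ) ^ 4) ≤ l := Real.log_le_log (by norm_num) (by norm_num; exact h16)
    rw [Real.log_pow] at this
    exact_mod_cast this
  have hlog2 := Real.log_two_gt_d9
  have hL : (Nat.log 2 n : ℝ) * Real.log 2 ≤ l := by
    rw [← Real.log_pow]
    refine Real.log_le_log (by positivity) (le_trans ?_ hnle)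
    exact_mod_cast Nat.pow_log_le_self 2 (by omega)
  have hL3 : ((Nat.log 2 n + 1 : ℕ) : ℝ) ≤ 3 * l := by
    push_cast
    have : (0 : ℝ) ≤ (Nat.log 2 n : ℝ) := by positivity
    nlinarith
  have hlpos : 0 < l := by linarith
  have hXpos : 0 < (X * M * K)⁻¹ := by
    have : 0 < X := by linarith
    have : 0 < M := by linarith
    have : 0 < K := by linarith
    positivity
  have hTT : ∀ a' b' : ℕ → ℂ, (∀ m, ‖a' m‖ ≤ ‖a m‖) → (∀ k, ‖b' k‖ ≤ ‖b k‖) →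
      ‖bsum s (Finset.range n) G a' b' (fun _ _ => True)‖ ≤ 
        (‖B‖ / 6 - (X * M * K)⁻¹) / l := by
    intro a' b' ha' hb'
    have := hc a' b' ha' hb'
    rw [le_div_iff₀ hlpos]
    have e : bsum s (Finset.range n) G a' b' (fun _ _ => True) =
      ∑ m ∈ s, ∑ k ∈ Finset.range n,
              (if M ≤ (m : ℝ) ∧ (m : ℝ) < 2 * M ∧ K ≤ (k : ℝ) ∧ (k : ℝ) < 2 * K
               then a' m * b' k * F (m * k) else 0) := by
      unfold bsum
      simp only [if_true, hG, mul_ite, mul_zero]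
    rw [e]
    linarith
  have b1 := bsum_nat_bound s n G a b _ hTT g
  have b2 := bsum_nat_bound s n G a b _ hTT h
  have hT0 : 0 ≤ (‖B‖ / 6 - (X * M * K)⁻¹) / l :=
    (norm_nonneg _).trans (hTT a b (fun _ => le_rfl) (fun _ => le_rfl))
  have b3 := mul_le_mul_of_nonneg_right hL3 hT0
  have e3 : 3 * l * ((‖B‖ / 6 - (X * M * K)⁻¹) / l) = 3 * (‖B‖ / 6 - (X * M * K)⁻¹) := by
    field_simp
  have b4 := norm_sub_le (bsum s (Finset.range n) G a b fun m k => k < g m)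
    (bsum s (Finset.range n) G a b fun m k => k < h m)
  rw [← hB] at b4
  linarith

/-- Lemma of bilinear form type, Lemma 2.3/Lemma A of the paper. -/
theorem statement8 :
    ∃ C : ℝ, 0 < C ∧
    ∀ (X M K : ℝ) (F : ℕ → ℂ) (a b : ℕ → ℂ),
    2 ≤ X → 2 ≤ M → 2 ≤ K →
    (∀ x : ℕ, ‖F x‖ ≤ X) → (∀ m : ℕ, ‖a m‖ ≤ 1) → (∀ k : ℕ, ‖b k‖ ≤ 1) →
    ((∃ a' b' : ℕ → ℂ, (∀ m : ℕ, ‖a' m‖ ≤ ‖a m‖) ∧ (∀ k : ℕ, ‖b' k‖ ≤ ‖b k‖) ∧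
      ‖∑ m ∈ Finset.range (⌊2 * M⌋₊ + 1), ∑ k ∈ Finset.range (⌊2 * K⌋₊ + 1),
          (if M ≤ (m : ℝ) ∧ (m : ℝ) < 2 * M ∧ K ≤ (k : ℝ) ∧ (k : ℝ) < 2 * K ∧ m < k
           then a m * b k * F (m * k) else 0)‖ ≤
        C * (Real.log (2 * M * K * X) *
            ‖∑ m ∈ Finset.range (⌊2 * M⌋₊ + 1), ∑ k ∈ Finset.range (⌊2 * K⌋₊ + 1),
              (if M ≤ (m : ℝ) ∧ (m : ℝ) < 2 * M ∧ K ≤ (k : ℝ) ∧ (k : ℝ) < 2 * K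
               then a' m * b' k * F (m * k) else 0)‖ + (X * M * K)⁻¹)) ∧
     (∀ U U' : ℝ, U < U' →
      ∃ a' b' : ℕ → ℂ, (∀ m : ℕ, ‖a' m‖ ≤ ‖a m‖) ∧ (∀ k : ℕ, ‖b' k‖ ≤ ‖b k‖) ∧
      ‖∑ m ∈ Finset.range (⌊2 * M⌋₊ + 1), ∑ k ∈ Finset.range (⌊2 * K⌋₊ + 1),
          (if M ≤ (m : ℝ) ∧ (m : ℝ) < 2 * M ∧ K ≤ (k : ℝ) ∧ (k : ℝ) < 2 * K ∧
              U ≤ ((m * k : ℕ) : ℝ) ∧ ((m * k : ℕ) : ℝ) < U'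
           then a m * b k * F (m * k) else 0)‖ ≤
        C * (Real.log (2 * M * K * X) *
            ‖∑ m ∈ Finset.range (⌊2 * M⌋₊ + 1), ∑ k ∈ Finset.range (⌊2 * K⌋₊ + 1),
              (if M ≤ (m : ℝ) ∧ (m : ℝ) < 2 * M ∧ K ≤ (k : ℝ) ∧ (k : ℝ) < 2 * K
               then a' m * b' k * F (m * k) else 0)‖ + (X * M * K)⁻¹))) := by
  refine ⟨6, by norm_num, ?_⟩
  intro X M K F a b hX hM hK _ _ _
  refine ⟨?_, ?_⟩
  · refine key X M K F a b hX hM hK _ ⟨fun _ => ⌊2 * K⌋₊ + 1, fun m => m + 1, ?_⟩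
    unfold bsum
    rw [← Finset.sum_sub_distrib]
    refine Finset.sum_congr rfl fun m _ => ?_
    rw [← Finset.sum_sub_distrib]
    refine Finset.sum_congr rfl fun k hk => ?_
    rw [Finset.mem_range] at hk
    simp only [hk, if_true]
    by_cases h : M ≤ (m : ℝ) ∧ (m : ℝ) < 2 * M ∧ K ≤ (k : ℝ) ∧ (k : ℝ) < 2 * K
    · by_cases h' : m < k
      · have : ¬ k < m + 1 := by omega
        simp [h, h', this]
      · have : k < m + 1 := by omega
        simp [h, h', this]
    · have h2 : ¬ (M ≤ (m : ℝ) ∧ (m : ℝ) < 2 * M ∧ K ≤ (k : ℝ) ∧ (k : ℝ) < 2 * K ∧ m < k) := by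
        tauto
      rw [if_neg h2, if_neg h]
      simp
  · intro U U' hU
    refine key X M K F a b hX hM hK _ ⟨fun m => ⌈U' / m⌉₊, fun m => ⌈U / m⌉₊, ?_⟩
    unfold bsum
    rw [← Finset.sum_sub_distrib]
    refine Finset.sum_congr rfl fun m _ => ?_
    rw [← Finset.sum_sub_distrib]
    refine Finset.sum_congr rfl fun k hk => ?_
    by_cases h : M ≤ (m : ℝ) ∧ (m : ℝ) < 2 * M ∧ K ≤ (k : ℝ) ∧ (k : ℝ) < 2 * K
    · have hm : (0 : ℝ) < m := by linarith [h.1]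
      have hV : ∀ V : ℝ, k < ⌈V / m⌉₊ ↔ ((m * k : ℕ) : ℝ) < V := by
        intro V
        rw [Nat.lt_ceil, lt_div_iff₀ hm]
        push_cast
        rw [mul_comm]
      simp only [hV]
      obtain ⟨h1, h2, h3, h4⟩ := h
      simp only [h1, h2, h3, h4, true_and, and_self, if_true]
      by_cases c1 : ((m * k : ℕ) : ℝ) < U
      · have c2 : ((m * k : ℕ) : ℝ) < U' := by linarith
        rw [if_pos c2, if_pos c1, if_neg (by intro h; linarith [h.1]), sub_self]
      · rw [if_neg c1, sub_zero]
        have c2 : U ≤ ((m * k : ℕ) : ℝ) := not_lt.mp c1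
        simp only [c2, true_and]
    · dsimp only
      rw [if_neg h, if_neg (by tauto)]
      simp
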